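/- For every θ ∈ [0, π] and every γ ∈ [0, π/2], the forward time delay is nonnegative: Δt_f = 2γ − θ·(1 − cos γ) ≥ 0. -/

import Mathlib

open Real

/-- For `θ ∈ [0, π]` and `γ ∈ [0, π/2]`, the forward time delay
`Δt_f = 2γ − θ(1 − cos γ)` is nonnegative. -/
theorem forward_delay_nonneg (θ γ : ℝ) (hθ : θ ∈ Set.Icc 0 π)
    (hγ : γ ∈ Set.Icc 0 (π / 2)) :
    2 * γ - θ * (1 - Real.cos γ) ≥ 0 := by
  obtain ⟨h1, h2⟩ := hθ
  obtain ⟨g1, g2⟩ := hγ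
  have hs := Real.mul_le_sin (x := π / 2 - γ) (by linarith) (by linarith)
  rw [Real.sin_pi_div_two_sub] at hs
  have hp := Real.pi_pos
  have e : π * (2 / π * (π / 2 - γ)) = π - 2 * γ := by
    field_simp
  have h3 := mul_le_mul_of_nonneg_left hs hp.le
  rw [e] at h3
  have h4 := mul_le_mul_of_nonneg_right h2 (sub_nonneg.2 (Real.cos_le_one γ))
  linarith
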